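/- For every a > −1, the dimensionless specific heat ĉ_V(γ) = r(γ, a) − γ · ∂r/∂γ(γ, a) converges in the ultrarelativistic limit γ → 0⁺ to 3 when −1 < a ≤ 2, and to a + 1 when a > 2. -/

import Mathlib

open MeasureTheory Real Filter Set

/-- Modified Bessel function of the second kind, integral representation. -/
noncomputable def besselK (n : ℕ) (x : ℝ) : ℝ :=
  ∫ t in Set.Ioi (0 : ℝ), Real.exp (-x * Real.cosh t) * Real.cosh (n * t)

/-- Dimensionless energy-to-pressure ratio `r(γ, a) = e/p` of a relativistic
gas with internal structure, state-density measure `φ(I) = I^a`. -/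
noncomputable def rRatio (γ a : ℝ) : ℝ :=
  (∫ s in Set.Ioi γ, (besselK 3 s - besselK 2 s / s) * (s - γ) ^ a) /
  (∫ s in Set.Ioi γ, (besselK 2 s / s) * (s - γ) ^ a)

open Topology

/-- Integrand. -/
noncomputable def eK (γ q t : ℝ) : ℝ := Real.exp (-γ * Real.cosh t) * (Real.cosh t) ^ q

/-- The basic integral. -/
noncomputable def jK (q γ : ℝ) : ℝ := ∫ t in Set.Ioi (0 : ℝ), eK γ q t

lemma eK_pos (γ q t : ℝ) : 0 < eK γ q t :=
  mul_pos (Real.exp_pos _) (Real.rpow_pos_of_pos (Real.cosh_pos t) _)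

lemma eK_mul_cosh (γ q t : ℝ) : eK γ q t * Real.cosh t = eK γ (q + 1) t := by
  unfold eK
  rw [Real.rpow_add_one (Real.cosh_pos t).ne', mul_assoc]

lemma eK_mul_cosh_sq (γ q t : ℝ) : eK γ q t * Real.cosh t ^ 2 = eK γ (q + 2) t := by
  rw [show q + 2 = q + 1 + 1 by ring, ← eK_mul_cosh, ← eK_mul_cosh]; ring

lemma eK_mono (γ t : ℝ) {q p : ℝ} (h : q ≤ p) : eK γ q t ≤ eK γ p t := by
  unfold eK
  have := Real.rpow_le_rpow_of_exponent_le (Real.one_le_cosh t) h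
  gcongr

lemma continuous_eK (γ q : ℝ) : Continuous (eK γ q) := by
  unfold eK
  refine (by fun_prop : Continuous fun t => Real.exp (-γ * Real.cosh t)).mul ?_
  exact Real.continuous_cosh.rpow_const fun t => Or.inl (Real.cosh_pos t).ne'

lemma half_exp_le_cosh (t : ℝ) : Real.exp t / 2 ≤ Real.cosh t := by
  rw [Real.cosh_eq]
  have := Real.exp_pos (-t)
  linarith

lemma tendsto_cosh_top : Tendsto Real.cosh atTop atTop :=
  tendsto_atTop_mono half_exp_le_cosh (Real.tendsto_exp_atTop.atTop_div_const two_pos)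

lemma tendsto_eK {γ q : ℝ} (h : 0 < γ ∨ (γ = 0 ∧ q < 0)) :
    Tendsto (eK γ q) atTop (𝓝 0) := by
  rcases h with h | ⟨rfl, h⟩
  · refine ((tendsto_rpow_mul_exp_neg_mul_atTop_nhds_zero q γ h).comp tendsto_cosh_top).congr ?_
    intro t
    simp [eK, mul_comm]
  · have := (tendsto_rpow_neg_atTop (y := -q) (by linarith)).comp tendsto_cosh_top
    refine this.congr ?_
    intro t
    simp [eK]

lemma integrable_cosh_rpow {q : ℝ} (h : q < 0) : IntegrableOn (eK 0 q) (Ioi 0) := by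
  refine integrable_of_isBigO_exp_neg (b := -q) (by linarith) (continuous_eK _ _).continuousOn ?_
  refine Asymptotics.IsBigO.of_bound ((1/2 : ℝ) ^ q) (Eventually.of_forall fun t => ?_)
  rw [Real.norm_of_nonneg (eK_pos _ _ _).le, Real.norm_of_nonneg (Real.exp_pos _).le]
  have h1 : Real.cosh t ^ q ≤ (Real.exp t / 2) ^ q :=
    Real.rpow_le_rpow_of_nonpos (by positivity) (half_exp_le_cosh t) h.le
  have h2 : (Real.exp t / 2) ^ q = (1/2 : ℝ) ^ q * Real.exp (- -q * t) := by
    rw [show Real.exp t / 2 = (1/2) * Real.exp t by ring,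
      Real.mul_rpow (by norm_num) (Real.exp_pos _).le, ← Real.exp_mul]
    ring_nf
  rw [← h2]
  simpa [eK] using h1

lemma integrable_eK {γ q : ℝ} (h : 0 < γ ∨ (γ = 0 ∧ q < 0)) : IntegrableOn (eK γ q) (Ioi 0) := by
  rcases h with h | ⟨rfl, h⟩
  · refine integrable_of_isBigO_exp_neg (b := 1) one_pos (continuous_eK _ _).continuousOn ?_
    have h1 : (eK γ (q+1)) =O[atTop] (fun _ => (1:ℝ)) :=
      (tendsto_eK (Or.inl h)).isBigO_one ℝ
    have h2 : (fun t => (Real.cosh t)⁻¹) =O[atTop] (fun t => Real.exp (-1 * t)) := by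
      refine Asymptotics.IsBigO.of_bound 2 (Eventually.of_forall fun t => ?_)
      rw [Real.norm_of_nonneg (inv_nonneg.2 (Real.cosh_pos t).le),
        Real.norm_of_nonneg (Real.exp_pos _).le]
      have := inv_anti₀ (by positivity) (half_exp_le_cosh t)
      refine this.trans (le_of_eq ?_)
      rw [show -1 * t = -t by ring, Real.exp_neg]
      field_simp
    refine ((h1.mul h2).congr_left ?_).congr_right (fun t => one_mul _)
    intro t
    rw [← eK_mul_cosh, mul_assoc, mul_inv_cancel₀ (Real.cosh_pos t).ne', mul_one]
  · exact integrable_cosh_rpow h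

lemma jK_ibp {γ p : ℝ} (h : 0 < γ ∨ (γ = 0 ∧ p < 0)) :
    γ * (jK (p+1) γ - jK (p-1) γ) = p * jK p γ - (p - 1) * jK (p-2) γ := by
  have i0 : IntegrableOn (eK γ p) (Ioi 0) := integrable_eK h
  have i1 : IntegrableOn (eK γ (p-1)) (Ioi 0) :=
    integrable_eK (h.imp id fun h => ⟨h.1, by linarith [h.2]⟩)
  have i2 : IntegrableOn (eK γ (p-2)) (Ioi 0) :=
    integrable_eK (h.imp id fun h => ⟨h.1, by linarith [h.2]⟩)
  have i3 : IntegrableOn (fun t => γ * eK γ (p+1) t) (Ioi 0) := by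
    rcases h with h | ⟨rfl, h⟩
    · exact (integrable_eK (Or.inl h)).const_mul γ
    · simp
  have key := integral_Ioi_of_hasDerivAt_of_tendsto' (a := 0) (m := 0)
    (f := fun t => eK γ (p-1) t * Real.sinh t)
    (f' := fun t => (p * eK γ p t - (p-1) * eK γ (p-2) t) -
      (γ * eK γ (p+1) t - γ * eK γ (p-1) t)) ?_ ?_ ?_
  · rw [integral_sub, integral_sub, integral_sub, integral_const_mul, integral_const_mul,
      integral_const_mul, integral_const_mul] at key
    · simp only [jK]
      simp at key
      linarith
    · exact i3
    · exact i1.const_mul γ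
    · exact i0.const_mul _
    · exact i2.const_mul _
    · exact (i0.const_mul _).sub (i2.const_mul _)
    · exact i3.sub (i1.const_mul γ)
  · intro t _
    have hc := Real.cosh_pos t
    have d1 : HasDerivAt (fun t => Real.exp (-γ * Real.cosh t))
        (Real.exp (-γ * Real.cosh t) * (-γ * Real.sinh t)) t :=
      ((Real.hasDerivAt_cosh t).const_mul (-γ)).exp
    have d2 := (Real.hasDerivAt_cosh t).rpow_const (p := p-1) (Or.inl hc.ne')
    have d3 := (d1.mul d2).mul (Real.hasDerivAt_sinh t)
    refine d3.congr_deriv ?_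
    rw [show p - 1 - 1 = p - 2 by ring]
    have e1 : eK γ (p-1) t = eK γ (p-2) t * Real.cosh t := by rw [eK_mul_cosh]; ring_nf
    have e2 : eK γ p t = eK γ (p-2) t * Real.cosh t ^ 2 := by rw [eK_mul_cosh_sq]; ring_nf
    have e3 : eK γ (p+1) t = eK γ (p-2) t * Real.cosh t ^ 3 := by
      rw [pow_succ, ← mul_assoc, eK_mul_cosh_sq, eK_mul_cosh]; ring_nf
    have e4 : Real.cosh t ^ (p-1) = Real.cosh t ^ (p-2) * Real.cosh t := by
      rw [← Real.rpow_add_one hc.ne']; ring_nf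
    rw [e1, e2, e3]
    simp only [eK, Pi.mul_apply, e4]
    have hs := Real.sinh_sq t
    linear_combination (Real.exp (-γ * Real.cosh t) * Real.cosh t ^ (p-2) * (-γ * Real.cosh t + p-1)) * hs
  · exact ((i0.const_mul _).sub (i2.const_mul _)).sub (i3.sub (i1.const_mul γ))
  · refine squeeze_zero_norm' ?_ (tendsto_eK h)
    filter_upwards [eventually_ge_atTop 0] with t ht
    rw [norm_mul, Real.norm_of_nonneg (eK_pos _ _ _).le,
      Real.norm_of_nonneg (Real.sinh_nonneg_iff.2 ht)]
    have : eK γ p t = eK γ (p-1) t * Real.cosh t := by rw [eK_mul_cosh]; ring_nf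
    rw [this]
    exact mul_le_mul_of_nonneg_left (Real.sinh_lt_cosh t).le (eK_pos _ _ _).le

lemma hasDerivAt_jK {γ : ℝ} (q : ℝ) (h : 0 < γ) : HasDerivAt (jK q) (-jK (q+1) γ) γ := by
  have := (hasDerivAt_integral_of_dominated_loc_of_deriv_le (μ := volume.restrict (Ioi (0:ℝ)))
    (F := fun γ t => eK γ q t) (F' := fun γ t => -eK γ (q+1) t) (x₀ := γ) (s := Ioi (γ/2))
    (bound := eK (γ/2) (q+1)) (Ioi_mem_nhds (by linarith)) ?_ ?_ ?_ ?_ ?_ ?_).2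
  · rw [integral_neg] at this
    exact this
  · exact Eventually.of_forall fun x => (continuous_eK x q).aestronglyMeasurable
  · exact integrable_eK (Or.inl h)
  · exact (continuous_eK _ _).neg.aestronglyMeasurable
  · refine Eventually.of_forall fun t x hx => ?_
    rw [norm_neg, Real.norm_of_nonneg (eK_pos _ _ _).le]
    unfold eK
    have := Real.cosh_pos t
    have hx' : γ/2 < x := hx
    gcongr
  · exact integrable_eK (Or.inl (by linarith))
  · refine Eventually.of_forall fun t x hx => ?_
    have d : HasDerivAt (fun x => Real.exp (-x * Real.cosh t))
        (Real.exp (-x * Real.cosh t) * (-1 * Real.cosh t)) x :=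
      ((hasDerivAt_neg x).mul_const (Real.cosh t)).exp
    refine (d.mul_const (Real.cosh t ^ q)).congr_deriv ?_
    rw [← eK_mul_cosh]; unfold eK; ring

lemma besselK_two_div {s : ℝ} (hs : 0 < s) : besselK 2 s / s = jK 3 s - jK 1 s := by
  have h := jK_ibp (γ := s) (p := 2) (Or.inl hs)
  have h2 : besselK 2 s = 2 * jK 2 s - jK 0 s := by
    unfold jK besselK
    rw [← integral_const_mul, ← integral_sub]
    · congr 1
      ext t
      have e : eK s 2 t = eK s 0 t * Real.cosh t ^ 2 := by rw [eK_mul_cosh_sq]; ring_nf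
      rw [e]
      have := Real.cosh_two_mul t
      have := Real.sinh_sq t
      simp only [eK, Real.rpow_zero]
      push_cast
      grind
    · exact (integrable_eK (Or.inl hs)).const_mul 2
    · exact (integrable_eK (Or.inl hs))
  norm_num at h
  rw [h2, div_eq_iff hs.ne']
  linarith

lemma besselK_three {s : ℝ} (hs : 0 < s) : besselK 3 s = 4 * jK 3 s - 3 * jK 1 s := by
  unfold jK besselK
  rw [← integral_const_mul, ← integral_const_mul, ← integral_sub]
  · congr 1
    ext t
    have e : eK s 3 t = eK s 1 t * Real.cosh t ^ 2 := by rw [eK_mul_cosh_sq]; ring_nf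
    rw [e]
    have := Real.cosh_three_mul t
    simp only [eK, Real.rpow_one]
    push_cast
    rw [this]
    ring
  · exact (integrable_eK (Or.inl hs)).const_mul _
  · exact (integrable_eK (Or.inl hs)).const_mul _

lemma shift_int (g : ℝ → ℝ) (γ : ℝ) :
    ∫ s in Ioi γ, g s = ∫ u in Ioi (0:ℝ), g (u + γ) := by
  have := (measurePreserving_add_right volume γ).setIntegral_preimage_emb
    (measurableEmbedding_addRight γ) g (Ioi γ)
  simpa using this.symm

lemma shift_integrable (g : ℝ → ℝ) (γ : ℝ) :
    IntegrableOn g (Ioi γ) ↔ IntegrableOn (fun u => g (u + γ)) (Ioi (0:ℝ)) := by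
  have := (measurePreserving_add_right volume γ).integrableOn_comp_preimage
    (measurableEmbedding_addRight γ) (f := g) (s := Ioi γ)
  rw [← this]
  simp [Function.comp_def]

lemma gam_int {a : ℝ} (ha : -1 < a) {c : ℝ} (hc : 0 < c) (γ : ℝ) :
    IntegrableOn (fun s => Real.exp (-s * c) * (s - γ) ^ a) (Ioi γ) ∧
    ∫ s in Ioi γ, Real.exp (-s * c) * (s - γ) ^ a =
      Real.Gamma (a+1) * (Real.exp (-γ * c) * c ^ (-a-1)) := by
  have e : ∀ u : ℝ, Real.exp (-(u+γ) * c) * (u + γ - γ) ^ a =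
      Real.exp (-γ * c) * (u ^ a * Real.exp (-(c * u))) := by
    intro u
    rw [add_sub_cancel_right, show -(u+γ)*c = -γ * c + -(c*u) by ring, Real.exp_add]; ring
  constructor
  · rw [shift_integrable]
    simp only [e]
    have := integrableOn_rpow_mul_exp_neg_mul_rpow ha one_pos hc
    simp only [Real.rpow_one, neg_mul] at this
    exact this.const_mul _
  · rw [shift_int]
    simp only [e]
    rw [integral_const_mul]
    have := Real.integral_rpow_mul_exp_neg_mul_Ioi (a := a+1) (by linarith) hc
    rw [add_sub_cancel_right] at this
    rw [this, one_div, Real.inv_rpow hc.le, ← Real.rpow_neg hc.le]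
    ring_nf

lemma jK_laplace {a : ℝ} (ha : -1 < a) {γ : ℝ} (hγ : 0 < γ) (q : ℝ) :
    IntegrableOn (fun s => jK q s * (s - γ) ^ a) (Ioi γ) ∧
    ∫ s in Ioi γ, jK q s * (s - γ) ^ a = Real.Gamma (a+1) * jK (q-a-1) γ := by
  let f : ℝ → ℝ → ℝ := fun s t => eK s q t * (s - γ) ^ a
  have fe : ∀ t s, f s t = Real.cosh t ^ q * (Real.exp (-s * Real.cosh t) * (s - γ) ^ a) := by
    intro t s; simp only [f, eK]; ring
  have fi : ∀ t, ∫ s in Ioi γ, f s t = Real.Gamma (a+1) * eK γ (q-a-1) t := by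
    intro t
    simp only [fe]
    have hc := Real.cosh_pos t
    rw [integral_const_mul, (gam_int ha hc γ).2, eK, show q - a - 1 = q + (-a-1) by ring,
      Real.rpow_add hc]
    ring
  have hf : Integrable (Function.uncurry f)
      ((volume.restrict (Ioi γ)).prod (volume.restrict (Ioi (0:ℝ)))) := by
    rw [integrable_prod_iff']
    · constructor
      · refine Eventually.of_forall fun t => ?_
        simp only [Function.uncurry_apply_pair, fe]
        exact (gam_int ha (Real.cosh_pos t) γ).1.const_mul _
      · have : ∀ t, ∫ s in Ioi γ, ‖Function.uncurry f (s, t)‖ =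
            Real.Gamma (a+1) * eK γ (q-a-1) t := by
          intro t
          rw [← fi]
          refine setIntegral_congr_fun measurableSet_Ioi fun s hs => ?_
          have : 0 ≤ s - γ := sub_nonneg.2 (le_of_lt hs)
          exact Real.norm_of_nonneg (mul_nonneg (eK_pos _ _ _).le (Real.rpow_nonneg this _))
        simp only [this]
        exact (integrable_eK (Or.inl hγ)).const_mul _
    · apply Measurable.aestronglyMeasurable
      simp only [f, eK, Function.uncurry_def]
      fun_prop
  have hsw := integral_integral_swap hf
  have e1 : ∀ s, ∫ t in Ioi (0:ℝ), f s t = jK q s * (s - γ) ^ a := by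
    intro s
    simp only [f]
    rw [integral_mul_const]; rfl
  constructor
  · have := hf.integral_prod_left
    simp only [Function.uncurry_apply_pair, e1] at this
    exact this
  · simp only [e1, fi] at hsw
    rw [hsw, integral_const_mul]; rfl

lemma jK_pos {γ : ℝ} (hγ : 0 < γ) (q : ℝ) : 0 < jK q γ := by
  unfold jK
  rw [setIntegral_pos_iff_support_of_nonneg_ae]
  · have : Function.support (eK γ q) = univ := by
      ext t; simp [(eK_pos γ q t).ne']
    simp [this]
  · exact Eventually.of_forall fun t => (eK_pos γ q t).le
  · exact integrable_eK (Or.inl hγ)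

lemma jK_sub_pos {γ q : ℝ} (h : 0 < γ ∨ (γ = 0 ∧ q + 2 < 0)) : 0 < jK (q+2) γ - jK q γ := by
  have i1 : IntegrableOn (eK γ (q+2)) (Ioi 0) := integrable_eK h
  have i2 : IntegrableOn (eK γ q) (Ioi 0) := integrable_eK (h.imp id fun h => ⟨h.1, by linarith [h.2]⟩)
  unfold jK
  rw [← integral_sub i1 i2]
  have e : ∀ t, eK γ (q+2) t - eK γ q t = eK γ q t * Real.sinh t ^ 2 := by
    intro t; rw [← eK_mul_cosh_sq, Real.sinh_sq]; ring
  simp only [e]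
  rw [setIntegral_pos_iff_support_of_nonneg_ae]
  · have : Function.support (fun t => eK γ q t * Real.sinh t ^ 2) = {0}ᶜ := by
      ext t; simp [(eK_pos γ q t).ne']
    rw [this, inter_eq_right.2]
    · simp
    · intro t (ht : 0 < t); exact ht.ne'
  · exact Eventually.of_forall fun t => mul_nonneg (eK_pos γ q t).le (sq_nonneg _)
  · exact (i1.sub i2).congr_fun (fun t _ => e t) measurableSet_Ioi

lemma rRatio_eq {a : ℝ} (ha : -1 < a) {γ : ℝ} (hγ : 0 < γ) :
    rRatio γ a = 3 + jK (-a) γ / (jK (2-a) γ - jK (-a) γ) := by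
  obtain ⟨i1, v1⟩ := jK_laplace ha hγ 1
  obtain ⟨i3, v3⟩ := jK_laplace ha hγ 3
  have hG : 0 < Real.Gamma (a+1) := Real.Gamma_pos_of_pos (by linarith)
  have hN : ∫ s in Ioi γ, (besselK 3 s - besselK 2 s / s) * (s - γ) ^ a =
      Real.Gamma (a+1) * (3 * jK (2-a) γ - 2 * jK (-a) γ) := by
    have : ∫ s in Ioi γ, (besselK 3 s - besselK 2 s / s) * (s - γ) ^ a =
        ∫ s in Ioi γ, (3 * (jK 3 s * (s - γ) ^ a) - 2 * (jK 1 s * (s - γ) ^ a)) := by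
      refine setIntegral_congr_fun measurableSet_Ioi fun s hs => ?_
      have hs0 : 0 < s := hγ.trans hs
      simp only [besselK_two_div hs0, besselK_three hs0]
      ring
    rw [this, integral_sub (i3.const_mul _) (i1.const_mul _), integral_const_mul,
      integral_const_mul, v1, v3]
    ring_nf
  have hD : ∫ s in Ioi γ, (besselK 2 s / s) * (s - γ) ^ a =
      Real.Gamma (a+1) * (jK (2-a) γ - jK (-a) γ) := by
    have : ∫ s in Ioi γ, (besselK 2 s / s) * (s - γ) ^ a =
        ∫ s in Ioi γ, ((jK 3 s * (s - γ) ^ a) - (jK 1 s * (s - γ) ^ a)) := by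
      refine setIntegral_congr_fun measurableSet_Ioi fun s hs => ?_
      have hs0 : 0 < s := hγ.trans hs
      simp only [besselK_two_div hs0]
      ring
    rw [this, integral_sub i3 i1, v1, v3]
    ring_nf
  have hB := jK_sub_pos (q := -a) (Or.inl hγ)
  rw [show -a + 2 = 2 - a by ring] at hB
  rw [rRatio, hN, hD, mul_div_mul_left _ _ hG.ne']
  field_simp
  ring

/-- closed form of the specific heat -/
lemma cV_eq {a : ℝ} (ha : -1 < a) {γ : ℝ} (hγ : 0 < γ) :
    rRatio γ a - γ * deriv (fun γ : ℝ => rRatio γ a) γ =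
      3 + (a - 1) * (jK (-a) γ / (jK (2-a) γ - jK (-a) γ))
        - (jK (-a) γ / (jK (2-a) γ - jK (-a) γ)) ^ 2
        + γ * (jK (1-a) γ / (jK (2-a) γ - jK (-a) γ)) := by
  have hB := jK_sub_pos (q := -a) (Or.inl hγ)
  rw [show -a + 2 = 2 - a by ring] at hB
  have hd : HasDerivAt (fun γ : ℝ => 3 + jK (-a) γ / (jK (2-a) γ - jK (-a) γ)) _ γ :=
    ((hasDerivAt_jK (-a) hγ).div ((hasDerivAt_jK (2-a) hγ).sub (hasDerivAt_jK (-a) hγ))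
      hB.ne').const_add 3
  have heq : (fun γ : ℝ => rRatio γ a) =ᶠ[𝓝 γ]
      fun γ : ℝ => 3 + jK (-a) γ / (jK (2-a) γ - jK (-a) γ) := by
    filter_upwards [Ioi_mem_nhds hγ] with x hx using rRatio_eq ha hx
  rw [heq.deriv_eq, hd.deriv, rRatio_eq ha hγ]
  have hib := jK_ibp (γ := γ) (p := 2 - a) (Or.inl hγ)
  rw [show 2 - a - 1 = 1 - a by ring, show 2 - a - 2 = -a by ring] at hib
  rw [show -a + 1 = 1 - a by ring]
  simp only [Pi.sub_apply]
  field_simp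
  linear_combination (-jK (-a) γ) * hib

lemma tendsto_jK_neg {q : ℝ} (h : q < 0) : Tendsto (jK q) (𝓝[>] 0) (𝓝 (jK q 0)) := by
  unfold jK
  refine tendsto_integral_filter_of_dominated_convergence (eK 0 q) ?_ ?_ (integrable_cosh_rpow h) ?_
  · exact Eventually.of_forall fun x => (continuous_eK x q).aestronglyMeasurable
  · filter_upwards [self_mem_nhdsWithin] with γ (hγ : 0 < γ)
    refine Eventually.of_forall fun t => ?_
    rw [Real.norm_of_nonneg (eK_pos _ _ _).le]
    unfold eK
    have := Real.cosh_pos t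
    gcongr
  · refine Eventually.of_forall fun t => ?_
    have : Continuous fun γ => eK γ q t := by unfold eK; fun_prop
    exact (this.tendsto 0).mono_left nhdsWithin_le_nhds

lemma jK_mono {γ q p : ℝ} (hγ : 0 < γ) (h : q ≤ p) : jK q γ ≤ jK p γ :=
  setIntegral_mono (integrable_eK (Or.inl hγ)) (integrable_eK (Or.inl hγ)) fun t => eK_mono γ t h

lemma tendsto_jK_top {p : ℝ} (h : 0 ≤ p) : Tendsto (jK p) (𝓝[>] 0) atTop := by
  rw [tendsto_atTop]
  intro M
  set T : ℝ := |M| + 1 with hT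
  have hT0 : 0 < T := by positivity
  have hlim : Tendsto (fun γ : ℝ => T * Real.exp (-γ * Real.cosh T)) (𝓝[>] 0) (𝓝 T) := by
    have : Continuous fun γ : ℝ => T * Real.exp (-γ * Real.cosh T) := by fun_prop
    have := (this.tendsto 0).mono_left (nhdsWithin_le_nhds (s := Ioi 0))
    simpa using this
  have hM : M < T := by linarith [le_abs_self M]
  filter_upwards [self_mem_nhdsWithin, hlim.eventually (lt_mem_nhds hM)] with γ (hγ : 0 < γ) h1
  refine h1.le.trans (le_trans ?_ (jK_mono hγ h))
  unfold jK
  calc T * Real.exp (-γ * Real.cosh T) = ∫ t in Ioc 0 T, Real.exp (-γ * Real.cosh T) := by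
        simp [hT0.le]
    _ ≤ ∫ t in Ioc 0 T, eK γ 0 t := by
        refine setIntegral_mono_on (by simp) ((integrable_eK (Or.inl hγ)).mono_set Ioc_subset_Ioi_self)
          measurableSet_Ioc fun t ht => ?_
        have : Real.cosh t ≤ Real.cosh T := by
          rw [Real.cosh_le_cosh, abs_of_pos ht.1, abs_of_pos hT0]; exact ht.2
        simp only [eK, Real.rpow_zero, mul_one]
        apply Real.exp_le_exp.2
        nlinarith
    _ ≤ _ := setIntegral_mono_set (integrable_eK (Or.inl hγ))
        (Eventually.of_forall fun t => (eK_pos _ _ _).le) Ioc_subset_Ioi_self.eventuallyLE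

lemma tendsto_ratio {p : ℝ} (h : 0 ≤ p) :
    Tendsto (fun γ => jK (p-2) γ / jK p γ) (𝓝[>] 0) (𝓝 0) := by
  rw [Metric.tendsto_nhds]
  intro ε hε
  -- pointwise bound
  obtain ⟨C, hC0, hC⟩ : ∃ C : ℝ, 0 ≤ C ∧ ∀ c : ℝ, 1 ≤ c →
      c ^ (p-2) ≤ ε/2 * c ^ p + C * c ^ (-1 : ℝ) := by
    set M : ℝ := max 1 (2/ε) with hM
    have hM1 : 1 ≤ M := le_max_left _ _
    refine ⟨M ^ (|p-1|), by positivity, fun c hc => ?_⟩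
    have hc0 : 0 < c := by linarith
    rcases le_total M c with h1 | h1
    · have e : c ^ p = c ^ (p-2) * c ^ 2 := by
        rw [← Real.rpow_natCast, ← Real.rpow_add hc0]; norm_num
      have : 1 ≤ ε/2 * c^2 := by
        have h2 : 2/ε ≤ c := (le_max_right _ _).trans h1
        have h3 : 2 ≤ c * ε := (div_le_iff₀ hε).1 h2
        nlinarith
      have h4 : 0 < c ^ (p-2) := by positivity
      have h5 : 0 ≤ M ^ (|p-1|) * c ^ (-1:ℝ) := by positivity
      rw [e]
      nlinarith
    · have e : c ^ (p-2) = c ^ (p-1) * c ^ (-1:ℝ) := by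
        rw [← Real.rpow_add hc0]; ring_nf
      have h2 : c ^ (p-1) ≤ M ^ (|p-1|) :=
        (Real.rpow_le_rpow_of_exponent_le hc (le_abs_self _)).trans
          (Real.rpow_le_rpow hc0.le h1 (abs_nonneg _))
      have h3 : 0 ≤ ε/2 * c ^ p := by positivity
      have h4 : 0 < c ^ (-1:ℝ) := by positivity
      rw [e]
      nlinarith
  have hb := tendsto_jK_neg (q := -1) (by norm_num)
  have hq : Tendsto (fun γ => C * (jK (-1) γ / jK p γ)) (𝓝[>] 0) (𝓝 (C * 0)) :=
    (hb.div_atTop (tendsto_jK_top h)).const_mul C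
  rw [mul_zero] at hq
  filter_upwards [self_mem_nhdsWithin, hq.eventually (gt_mem_nhds (half_pos hε))] with γ (hγ : 0 < γ) h1
  have hp := jK_pos hγ p
  have hp2 := jK_pos hγ (p-2)
  rw [Real.dist_eq, sub_zero, abs_of_pos (by positivity), div_lt_iff₀ hp]
  have key : jK (p-2) γ ≤ ε/2 * jK p γ + C * jK (-1) γ := by
    unfold jK
    have j1 : IntegrableOn (eK γ p) (Ioi 0) := integrable_eK (Or.inl hγ)
    have j2 : IntegrableOn (eK γ (-1)) (Ioi 0) := integrable_eK (Or.inl hγ)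
    rw [← integral_const_mul, ← integral_const_mul,
      ← integral_add (j1.const_mul _) (j2.const_mul _)]
    refine setIntegral_mono (integrable_eK (Or.inl hγ)) ((j1.const_mul _).add (j2.const_mul _))
      fun t => ?_
    have := mul_le_mul_of_nonneg_left (hC _ (Real.one_le_cosh t)) (Real.exp_pos (-γ * Real.cosh t)).le
    simp only [eK]
    linarith
  rw [← mul_div_assoc, div_lt_iff₀ hp] at h1
  linarith

/-- Ultrarelativistic limit of the dimensionless specific heat
`ĉ_V(γ) = r(γ, a) - γ ∂r/∂γ(γ, a)`: it tends to `3` when `-1 < a ≤ 2` and to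
`a + 1` when `a > 2`, as `γ → 0⁺`. -/
theorem specific_heat_ultrarelativistic_limit (a : ℝ) (ha : -1 < a) :
    (a ≤ 2 →
      Filter.Tendsto
        (fun γ : ℝ => rRatio γ a - γ * deriv (fun γ : ℝ => rRatio γ a) γ)
        (nhdsWithin 0 (Set.Ioi 0)) (nhds 3)) ∧
    (2 < a →
      Filter.Tendsto
        (fun γ : ℝ => rRatio γ a - γ * deriv (fun γ : ℝ => rRatio γ a) γ)
        (nhdsWithin 0 (Set.Ioi 0)) (nhds (a + 1))) := by
  have hid : Tendsto (fun γ : ℝ => γ) (𝓝[>] 0) (𝓝 0) := nhdsWithin_le_nhds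
  have heq : ∀ᶠ γ in 𝓝[>] (0:ℝ), _ = _ :=
    eventually_of_mem self_mem_nhdsWithin fun γ (hγ : 0 < γ) => (cV_eq ha hγ).symm
  constructor
  · intro h2
    have hr := tendsto_ratio (p := 2 - a) (by linarith)
    rw [show 2 - a - 2 = -a by ring] at hr
    have hx : Tendsto (fun γ => jK (-a) γ / (jK (2-a) γ - jK (-a) γ)) (𝓝[>] 0) (𝓝 0) := by
      have := hr.div (hr.const_sub 1) (by norm_num)
      rw [zero_div] at this
      refine this.congr' ?_
      filter_upwards [self_mem_nhdsWithin] with γ (hγ : 0 < γ)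
      have h1 := jK_pos hγ (2-a)
      simp only [Pi.div_apply]
      rw [one_sub_div h1.ne', div_div_div_cancel_right₀ h1.ne']
    have hy : Tendsto (fun γ => γ * (jK (1-a) γ / (jK (2-a) γ - jK (-a) γ))) (𝓝[>] 0) (𝓝 0) := by
      have hu : Tendsto (fun γ => γ * (1 + jK (-a) γ / (jK (2-a) γ - jK (-a) γ)))
          (𝓝[>] 0) (𝓝 0) := by
        simpa using hid.mul (hx.const_add 1)
      refine squeeze_zero' ?_ ?_ hu
      · filter_upwards [self_mem_nhdsWithin] with γ (hγ : 0 < γ)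
        have hB := jK_sub_pos (q := -a) (Or.inl hγ)
        rw [show -a + 2 = 2 - a by ring] at hB
        have := jK_pos hγ (1-a)
        positivity
      · filter_upwards [self_mem_nhdsWithin] with γ (hγ : 0 < γ)
        have hB := jK_sub_pos (q := -a) (Or.inl hγ)
        rw [show -a + 2 = 2 - a by ring] at hB
        have := jK_mono hγ (show 1 - a ≤ 2 - a by linarith)
        refine mul_le_mul_of_nonneg_left ?_ hγ.le
        rw [one_add_div hB.ne']
        gcongr
        linarith
    refine Tendsto.congr' heq ?_
    have := (((hx.const_mul (a-1)).const_add 3).sub (hx.pow 2)).add hy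
    simpa using this
  · intro h2
    have t0 := tendsto_jK_neg (q := -a) (by linarith)
    have t1 := tendsto_jK_neg (q := 1-a) (by linarith)
    have t2 := tendsto_jK_neg (q := 2-a) (by linarith)
    have hB := jK_sub_pos (γ := 0) (q := -a) (Or.inr ⟨rfl, by linarith⟩)
    rw [show -a + 2 = 2 - a by ring] at hB
    have hx := t0.div (t2.sub t0) hB.ne'
    have hz := t1.div (t2.sub t0) hB.ne'
    have hib := jK_ibp (γ := 0) (p := 2 - a) (Or.inr ⟨rfl, by linarith⟩)
    rw [show 2 - a - 2 = -a by ring] at hib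
    have hv : jK (-a) 0 / (jK (2-a) 0 - jK (-a) 0) = a - 2 := by
      rw [div_eq_iff hB.ne']; linarith
    rw [hv] at hx
    refine Tendsto.congr' heq ?_
    have := (((hx.const_mul (a-1)).const_add 3).sub (hx.pow 2)).add (hid.mul hz)
    have e : 3 + (a - 1) * (a - 2) - (a - 2) ^ 2 +
        0 * (jK (1 - a) 0 / (jK (2 - a) 0 - jK (-a) 0)) = a + 1 := by ring
    rw [e] at this
    exact this
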